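/- In the P3 setup, fix an index i and suppose additionally: D_i is differentiable with D_i'(x) ≥ D'_{i,min} for all x ∈ [x_{i,min}, x_{i,max}]; p_s ≥ p_{s,min}; the perturbation parameter satisfies β_i = V·(p_{b,max} + D'_{i,max}) − x_{i,min} + s_{i,min} for constants p_{b,max} ≥ p_b and D'_{i,max} ≥ D_i'(x) on [x_{i,min}, x_{i,max}]; and s_i > β_i − V·(p_{s,min} + D'_{i,min}). Then every minimizer u* = (x_1*,…,x_N*, l_m*, g*, e_b*, e_s*) of the P3 objective over the P3-feasible set satisfies x_i* = x_{i,min}. -/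

import Mathlib

/-- A control action `u = (x₁,…,x_N, l_m, g, e_b, e_s)` in the per-slot problem P3. -/
structure Ctrl (N : ℕ) where
  x : Fin N → ℝ
  lm : ℝ
  g : ℝ
  eb : ℝ
  es : ℝ

/-- P3-feasibility of a control action. -/
def P3Feasible {N : ℕ} (a xmin xmax : Fin N → ℝ) (lb lf gmax gprev r : ℝ)
    (u : Ctrl N) : Prop :=
  lb ≤ u.lm ∧ u.lm ≤ lb + lf ∧
  (∀ i, xmin i ≤ u.x i ∧ u.x i ≤ xmax i ∧ u.x i ≤ a i) ∧
  0 ≤ u.g ∧ u.g ≤ gmax ∧ |u.g - gprev| ≤ r * gmax ∧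
  0 ≤ u.eb ∧ 0 ≤ u.es ∧
  u.g + u.eb + ∑ i, (a i - u.x i) = u.es + u.lm

/-- The P3 objective
`f(u) = Σᵢ [V·Dᵢ(xᵢ) + (sᵢ − βᵢ)·xᵢ] + V·C(g) + V·p_b·e_b − V·p_s·e_s − (J/l_f)·l_m`. -/
noncomputable def P3Obj {N : ℕ} (s β : Fin N → ℝ) (D : Fin N → ℝ → ℝ) (C : ℝ → ℝ)
    (V pb ps J lf : ℝ) (u : Ctrl N) : ℝ :=
  (∑ i, (V * D i (u.x i) + (s i - β i) * u.x i)) + V * C u.g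
    + V * pb * u.eb - V * ps * u.es - (J / lf) * u.lm

theorem Fintype.sum_apply_update {ι α M : Type*} [Fintype ι] [DecidableEq ι] [AddCommGroup M]
    (F : ι → α → M) (x : ι → α) (i : ι) (c : α) :
    ∑ j, F j (Function.update x i c j) = ∑ j, F j (x j) + (F i c - F i (x i)) := by
  have herase : ∑ j ∈ Finset.univ.erase i, F j (Function.update x i c j) =
      ∑ j ∈ Finset.univ.erase i, F j (x j) :=
    Finset.sum_congr rfl fun j hj => by
      rw [Function.update_of_ne (Finset.ne_of_mem_erase hj)]
  rw [← Finset.add_sum_erase _ _ (Finset.mem_univ i), herase,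
    ← Finset.add_sum_erase _ (fun j => F j (x j)) (Finset.mem_univ i), Function.update_self]
  abel

/-- Lower the charging amount `x i` to `c` and sell the energy gained. -/
def Ctrl.dischargeAndSell {N : ℕ} (u : Ctrl N) (i : Fin N) (c : ℝ) : Ctrl N :=
  { u with x := Function.update u.x i c, es := u.es + (u.x i - c) }

theorem P3Feasible.dischargeAndSell {N : ℕ} {a xmin xmax : Fin N → ℝ}
    {lb lf gmax gprev r : ℝ} {u : Ctrl N}
    (h : P3Feasible a xmin xmax lb lf gmax gprev r u) {i : Fin N} {c : ℝ}
    (hc : xmin i ≤ c) (hcu : c ≤ u.x i) :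
    P3Feasible a xmin xmax lb lf gmax gprev r (u.dischargeAndSell i c) := by
  obtain ⟨hlm, hlm', hx, hg, hg', hramp, heb, hes, hbal⟩ := h
  refine ⟨hlm, hlm', fun j => ?_, hg, hg', hramp, heb, ?_, ?_⟩
  · rcases eq_or_ne j i with rfl | hj
    · simpa [Ctrl.dischargeAndSell] using
        ⟨hc, hcu.trans (hx j).2.1, hcu.trans (hx j).2.2⟩
    · simpa [Ctrl.dischargeAndSell, hj] using hx j
  · simp only [Ctrl.dischargeAndSell]
    linarith
  · simp only [Ctrl.dischargeAndSell]
    rw [Fintype.sum_apply_update (fun j y => a j - y)]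
    linarith

theorem P3Obj_dischargeAndSell {N : ℕ} (s β : Fin N → ℝ) (D : Fin N → ℝ → ℝ) (C : ℝ → ℝ)
    (V pb ps J lf : ℝ) (u : Ctrl N) (i : Fin N) (c : ℝ) :
    P3Obj s β D C V pb ps J lf (u.dischargeAndSell i c) =
      P3Obj s β D C V pb ps J lf u
        - (V * (D i (u.x i) - D i c) + (s i - β i + V * ps) * (u.x i - c)) := by
  simp only [P3Obj, Ctrl.dischargeAndSell]
  rw [Fintype.sum_apply_update (fun j y => V * D j y + (s j - β j) * y)]
  ring

/-- Lemma 2.2: forced discharging when the energy state is high. -/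
theorem stmt5 (N : ℕ) (a s β xmin xmax : Fin N → ℝ)
    (lb lf pb ps J gmax gprev r V : ℝ)
    (D : Fin N → ℝ → ℝ) (C : ℝ → ℝ)
    (ha : ∀ i, 0 ≤ a i) (hlb : 0 ≤ lb) (hlf : 0 < lf) (hJ : 0 ≤ J)
    (hxmin : ∀ i, xmin i < 0) (hxmax : ∀ i, 0 < xmax i)
    (hgmax : 0 < gmax) (hgprev : gprev ∈ Set.Icc 0 gmax)
    (hr : r ∈ Set.Icc (0 : ℝ) 1) (hV : 0 < V)
    (i : Fin N) (Dmin Dmax pbmax psmin smin : ℝ)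
    (hDdiff : ∀ x ∈ Set.Icc (xmin i) (xmax i), DifferentiableAt ℝ (D i) x)
    (hDmin : ∀ x ∈ Set.Icc (xmin i) (xmax i), Dmin ≤ deriv (D i) x)
    (hDmax : ∀ x ∈ Set.Icc (xmin i) (xmax i), deriv (D i) x ≤ Dmax)
    (hps : psmin ≤ ps) (hpb : pb ≤ pbmax)
    (hβ : β i = V * (pbmax + Dmax) - xmin i + smin)
    (hsi : s i > β i - V * (psmin + Dmin))
    (u : Ctrl N)
    (hfeas : P3Feasible a xmin xmax lb lf gmax gprev r u)
    (hmin : ∀ v, P3Feasible a xmin xmax lb lf gmax gprev r v →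
      P3Obj s β D C V pb ps J lf u ≤ P3Obj s β D C V pb ps J lf v) :
    u.x i = xmin i := by
  obtain ⟨hlow, hhigh, -⟩ := hfeas.2.2.1 i
  by_contra hne
  have hlt : xmin i < u.x i := lt_of_le_of_ne hlow (Ne.symm hne)
  have hle := hmin _ (hfeas.dischargeAndSell le_rfl hlow)
  rw [P3Obj_dischargeAndSell] at hle
  have hmvt : Dmin * (u.x i - xmin i) ≤ D i (u.x i) - D i (xmin i) :=
    (convex_Icc (xmin i) (xmax i)).mul_sub_le_image_sub_of_le_deriv
      (fun x hx => (hDdiff x hx).continuousAt.continuousWithinAt)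
      (fun x hx => (hDdiff x (interior_subset hx)).differentiableWithinAt)
      (fun x hx => hDmin x (interior_subset hx))
      _ ⟨le_rfl, hlow.trans hhigh⟩ _ ⟨hlow, hhigh⟩ hlow
  have hVD := mul_le_mul_of_nonneg_left hmvt hV.le
  have hVp := mul_le_mul_of_nonneg_left hps hV.le
  have hcoef : 0 < V * Dmin + (s i - β i + V * ps) := by linarith
  have hgain := mul_pos hcoef (sub_pos.mpr hlt)
  linarith
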